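/- For n = 5: (i) H_k⟦2, 3, 4, 2, 4⟧ ≅ ℤ/3ℤ if k = 3 and 0 otherwise; (ii) H_k⟦2, 3, 3, 3, 4⟧ ≅ ℤ/2ℤ if k = 3 and 0 otherwise; (iii) H_k⟦2, 3, 3, 4, 3⟧ ≅ ℤ/2ℤ if k = 4 and 0 otherwise; (iv) H_k⟦3, 3, 3, 3, 3⟧ = 0 for all k. -/

import Mathlib

namespace Nil

/-- Index pairs `(a,b)` with `a < b` in `Fin n`, indexing the basis `e_{ab}` of `nil_n`. -/
abbrev P (n : ℕ) : Type := {p : Fin n × Fin n // p.1 < p.2}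

/-- Lexicographic key of a pair. -/
def key {n : ℕ} (p : P n) : ℕ := p.1.1.1 * n + p.1.2.1

/-- Position (0-based) of `a` in the lexicographically sorted list of `M`. -/
def pos {n : ℕ} (M : Finset (P n)) (a : P n) : ℕ :=
  (M.filter fun b => key b < key a).card

/-- Basis of the degree `k` part of the Chevalley-Eilenberg complex `Λ^* nil_n`:
subsets `M` of pairs with `|M| = k` (empty for `k < 0`). -/
abbrev B (n : ℕ) (k : ℤ) : Type := {M : Finset (P n) // (M.card : ℤ) = k}

/-- Degree `k` chain group of the Chevalley-Eilenberg complex of `nil_n`. -/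
abbrev C (n : ℕ) (k : ℤ) : Type := B n k →₀ ℤ

/-- The Chevalley-Eilenberg boundary of a basis wedge `e_M`:
`∂(e_{a₁b₁} ∧ … ∧ e_{aₖbₖ}) = Σ_{i<j} (-1)^{i+j} [e_{aᵢbᵢ}, e_{aⱼbⱼ}] ∧ …` (omitting
the i-th and j-th factors), written in the lexicographically sorted basis.
For lexicographically sorted wedges the only nonzero brackets come from pairs
`a = (x,y)`, `b = (y,z)`, producing `±e_{(x,z)}`. -/
noncomputable def dAux {n : ℕ} (k : ℤ) (M : Finset (P n)) : C n k :=
  ∑ a ∈ M, ∑ b ∈ M,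
    if hab : a.1.2 = b.1.1 then
      (let c : P n := ⟨(a.1.1, b.1.2), lt_trans a.2 (by rw [hab]; exact b.2)⟩
       let M' : Finset (P n) := insert c ((M.erase a).erase b)
       if h' : (M'.card : ℤ) = k then
         ((-1 : ℤ) ^ (pos M a + pos M b + pos M' c)) • Finsupp.single (⟨M', h'⟩ : B n k) 1
       else 0)
    else 0

/-- The Chevalley-Eilenberg boundary map in degree `k+1`. -/
noncomputable def d (n : ℕ) (k : ℤ) : C n (k + 1) →ₗ[ℤ] C n k :=
  Finsupp.lsum ℤ fun M => LinearMap.toSpanSingleton ℤ (C n k) (dAux k M.1)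

/-- Degree-cast isomorphism. -/
noncomputable def castC (n : ℕ) {k l : ℤ} (h : k = l) : C n k ≃ₗ[ℤ] C n l :=
  Finsupp.domLCongr (Equiv.subtypeEquivRight fun _ => by rw [h])

/-- The boundary map out of degree `k`. -/
noncomputable def dFrom (n : ℕ) (k : ℤ) : C n k →ₗ[ℤ] C n (k - 1) :=
  (d n (k - 1)).comp (castC n (by ring : k = k - 1 + 1)).toLinearMap

/-- Cycles of `Λ^* nil_n` in degree `k`. -/
noncomputable def Zfull (n : ℕ) (k : ℤ) : Submodule ℤ (C n k) := LinearMap.ker (dFrom n k)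

noncomputable def HnilSub (n : ℕ) (k : ℤ) : Submodule ℤ (Zfull n k) :=
  Submodule.comap (Zfull n k).subtype (LinearMap.range (d n k) ⊓ Zfull n k)

/-- `H_k(nil_n; ℤ)`: the `k`-th integral homology of the Chevalley-Eilenberg complex
of the Lie ring of strictly upper triangular `n × n` integer matrices. -/
noncomputable def Hnil (n : ℕ) (k : ℤ) : Type := Zfull n k ⧸ HnilSub n k

noncomputable instance (n : ℕ) (k : ℤ) : AddCommGroup (Hnil n k) :=
  inferInstanceAs (AddCommGroup (Zfull n k ⧸ HnilSub n k))

noncomputable instance (n : ℕ) (k : ℤ) : Module ℤ (Hnil n k) :=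
  inferInstanceAs (Module ℤ (Zfull n k ⧸ HnilSub n k))

/-- The modified weight of a basis wedge `e_M` (indices of `Fin n` are 0-based, so the
`i`-th weight of the paper, `1 ≤ i ≤ n`, is `wt M ⟨i-1,_⟩`):
`w_i(e_M) = i - #{x : (x,i) ∈ M} + #{y : (i,y) ∈ M}`. -/
def wt {n : ℕ} (M : Finset (P n)) : Fin n → ℤ := fun i =>
  ((i.1 : ℤ) + 1) - (M.filter fun p => p.1.2 = i).card + (M.filter fun p => p.1.1 = i).card

/-- Basis wedges of degree `k` and modified weight `w`. -/
abbrev Bw (n : ℕ) (k : ℤ) (w : Fin n → ℤ) : Type :=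
  {M : Finset (P n) // (M.card : ℤ) = k ∧ wt M = w}

/-- Degree `k` part of the weight summand `⟦w⟧` of `Λ^* nil_n`. -/
abbrev Cw (n : ℕ) (k : ℤ) (w : Fin n → ℤ) : Type := Bw n k w →₀ ℤ

/-- Inclusion of the weight summand. -/
noncomputable def inclW (n : ℕ) (k : ℤ) (w : Fin n → ℤ) : Cw n k w →ₗ[ℤ] C n k :=
  Finsupp.lmapDomain ℤ ℤ fun M => (⟨M.1, M.2.1⟩ : B n k)

/-- Projection onto the weight summand. -/
noncomputable def projW (n : ℕ) (k : ℤ) (w : Fin n → ℤ) : C n k →ₗ[ℤ] Cw n k w :=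
  Finsupp.lsum ℤ fun M =>
    if h : wt M.1 = w then
      LinearMap.toSpanSingleton ℤ (Cw n k w) (Finsupp.single (⟨M.1, M.2, h⟩ : Bw n k w) 1)
    else 0

/-- The boundary of the weight summand `⟦w⟧` (the boundary preserves weights, so this
is the restriction of the Chevalley-Eilenberg boundary). -/
noncomputable def dW (n : ℕ) (k : ℤ) (w : Fin n → ℤ) : Cw n (k + 1) w →ₗ[ℤ] Cw n k w :=
  (projW n k w) ∘ₗ (d n k) ∘ₗ (inclW n (k + 1) w)

noncomputable def castCw (n : ℕ) (w : Fin n → ℤ) {k l : ℤ} (h : k = l) :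
    Cw n k w ≃ₗ[ℤ] Cw n l w :=
  Finsupp.domLCongr (Equiv.subtypeEquivRight fun _ => by rw [h])

noncomputable def dFromW (n : ℕ) (k : ℤ) (w : Fin n → ℤ) : Cw n k w →ₗ[ℤ] Cw n (k - 1) w :=
  (dW n (k - 1) w).comp (castCw n w (by ring : k = k - 1 + 1)).toLinearMap

noncomputable def ZW (n : ℕ) (k : ℤ) (w : Fin n → ℤ) : Submodule ℤ (Cw n k w) :=
  LinearMap.ker (dFromW n k w)

noncomputable def HwSub (n : ℕ) (k : ℤ) (w : Fin n → ℤ) : Submodule ℤ (ZW n k w) :=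
  Submodule.comap (ZW n k w).subtype (LinearMap.range (dW n k w) ⊓ ZW n k w)

/-- `H_k⟦w⟧`: the `k`-th homology of the weight summand `⟦w⟧` of `Λ^* nil_n`. -/
noncomputable def Hw (n : ℕ) (k : ℤ) (w : Fin n → ℤ) : Type := ZW n k w ⧸ HwSub n k w

noncomputable instance (n : ℕ) (k : ℤ) (w : Fin n → ℤ) : AddCommGroup (Hw n k w) :=
  inferInstanceAs (AddCommGroup (ZW n k w ⧸ HwSub n k w))

noncomputable instance (n : ℕ) (k : ℤ) (w : Fin n → ℤ) : Module ℤ (Hw n k w) :=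
  inferInstanceAs (Module ℤ (ZW n k w ⧸ HwSub n k w))

/-- `w ∈ 𝒮_n`: all entries lie in `{1,…,n}` and they add up to `binom (n+1) 2`. -/
def Sn (n : ℕ) (w : Fin n → ℤ) : Prop :=
  (∀ i, 1 ≤ w i ∧ w i ≤ (n : ℤ)) ∧ 2 * ∑ i, w i = (n : ℤ) * ((n : ℤ) + 1)

/-- Number of inversions of a permutation of `Fin n`. -/
def invCount (n : ℕ) (π : Equiv.Perm (Fin n)) : ℕ :=
  (Finset.univ.filter fun p : Fin n × Fin n => p.1 < p.2 ∧ π p.2 < π p.1).card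

/-- The weight sequence `(π(1), …, π(n))` attached to a permutation (1-based values). -/
def permWt (n : ℕ) (π : Equiv.Perm (Fin n)) : Fin n → ℤ := fun i => ((π i).1 : ℤ) + 1

/-- The set of inversions of a permutation, as a set of index pairs. -/
def invFinset {n : ℕ} (π : Equiv.Perm (Fin n)) : Finset (P n) :=
  Finset.univ.filter fun p => π p.1.2 < π p.1.1

/-- Index reversal `i ↦ n+1-i` (0-based: `i ↦ n-1-i`). -/
def rev {n : ℕ} (i : Fin n) : Fin n := ⟨n - 1 - i.1, by have := i.isLt; omega⟩

/-- The coefficient of `e_N` in the Chevalley-Eilenberg boundary of `e_M`. -/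
def bdryCoeff {n : ℕ} (M N : Finset (P n)) : ℤ :=
  ∑ a ∈ M, ∑ b ∈ M,
    if hab : a.1.2 = b.1.1 then
      (let c : P n := ⟨(a.1.1, b.1.2), lt_trans a.2 (by rw [hab]; exact b.2)⟩
       if insert c ((M.erase a).erase b) = N then
         (-1 : ℤ) ^ (pos M a + pos M b + pos N c)
       else 0)
    else 0

lemma dAux_apply {n : ℕ} (k : ℤ) (M : Finset (P n)) (N : B n k) :
    dAux k M N = bdryCoeff M N.1 := by
  obtain ⟨N, hN⟩ := N
  unfold dAux bdryCoeff
  rw [Finsupp.finsetSum_apply]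
  refine Finset.sum_congr rfl fun a _ => ?_
  rw [Finsupp.finsetSum_apply]
  refine Finset.sum_congr rfl fun b _ => ?_
  split_ifs with hab
  · dsimp only
    split_ifs with h₁ h₂ h₂
    · subst h₂
      simp
    · simp [Subtype.ext_iff, h₂]
    · exact absurd (h₂ ▸ hN) h₁
    · simp
  · simp

lemma projW_apply {n : ℕ} {k : ℤ} {w : Fin n → ℤ} (f : C n k) (N : Bw n k w) :
    projW n k w f N = f ⟨N.1, N.2.1⟩ := by
  induction f using Finsupp.induction_linear with
  | zero => simp
  | add f g hf hg => simp [hf, hg]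
  | single M c =>
    unfold projW
    rw [Finsupp.lsum_single]
    split_ifs with h
    · simp [Finsupp.single_apply, Subtype.ext_iff]
    · have hne : M.1 ≠ N.1 := fun hMN => h (hMN ▸ N.2.2)
      simp [Subtype.ext_iff, hne]

lemma dW_single_apply {n : ℕ} {k : ℤ} {w : Fin n → ℤ} (M : Bw n (k + 1) w) (c : ℤ)
    (N : Bw n k w) : dW n k w (Finsupp.single M c) N = c * bdryCoeff M.1 N.1 := by
  simp [dW, projW_apply, inclW, d, dAux_apply]

section Coordinates

variable {n : ℕ} {w : Fin n → ℤ} {ι : Type*}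

/-- The coordinates of a chain of `⟦w⟧` of degree `k` with respect to an enumeration of all the
basis wedges of modified weight `w`. -/
noncomputable def coords (e : ι ≃ {M : Finset (P n) // wt M = w}) (k : ℤ) :
    Cw n k w →ₗ[ℤ] ι → ℤ where
  toFun f i := if h : ((e i).1.card : ℤ) = k then f ⟨(e i).1, h, (e i).2⟩ else 0
  map_add' f g := by
    ext i
    by_cases h : ((e i).1.card : ℤ) = k <;> simp [h]
  map_smul' c f := by
    ext i
    by_cases h : ((e i).1.card : ℤ) = k <;> simp [h]

variable (e : ι ≃ {M : Finset (P n) // wt M = w})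

lemma coords_apply_of_eq {k : ℤ} (f : Cw n k w) {i : ι} (h : ((e i).1.card : ℤ) = k) :
    coords e k f i = f ⟨(e i).1, h, (e i).2⟩ := dif_pos h

lemma coords_apply_of_ne {k : ℤ} (f : Cw n k w) {i : ι} (h : ((e i).1.card : ℤ) ≠ k) :
    coords e k f i = 0 := dif_neg h

lemma coords_injective (k : ℤ) : Function.Injective (coords e k) := by
  intro f g hfg
  ext ⟨M, hk, hw⟩
  have hM : e (e.symm ⟨M, hw⟩) = ⟨M, hw⟩ := e.apply_symm_apply _
  have h := congrFun hfg (e.symm ⟨M, hw⟩)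
  rw [coords_apply_of_eq e f (by rw [hM]; exact hk),
    coords_apply_of_eq e g (by rw [hM]; exact hk)] at h
  simpa only [hM] using h

lemma coords_castCw {k l : ℤ} (h : k = l) (f : Cw n k w) :
    coords e l (castCw n w h f) = coords e k f := by
  subst h
  congr 1
  ext M
  simp [castCw]
  rfl

lemma exists_coords_eq (k : ℤ) (g : ι → ℤ) (hg : ∀ i, ((e i).1.card : ℤ) ≠ k → g i = 0) :
    ∃ f, coords e k f = g := by
  have : Finite (Bw n k w) := Subtype.finite
  refine ⟨Finsupp.equivFunOnFinite.symm fun M => g (e.symm ⟨M.1, M.2.2⟩), ?_⟩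
  ext i
  by_cases h : ((e i).1.card : ℤ) = k
  · simp [coords_apply_of_eq e _ h]
  · rw [coords_apply_of_ne e _ h, hg i h]

/-- `D` is the matrix, acting on row vectors, of the boundary of `⟦w⟧` with respect to the
enumeration `e`. -/
def IsBdryMatrix (D : Matrix ι ι ℤ) : Prop :=
  D = Matrix.of fun i j =>
    if (e i).1.card = (e j).1.card + 1 then bdryCoeff (e i).1 (e j).1 else 0

variable {e} [Fintype ι] {D S T : Matrix ι ι ℤ} {ψ z : ι → ℤ} {m : ℕ}

open scoped Matrix

lemma IsBdryMatrix.coords_dW (hD : IsBdryMatrix e D) {k : ℤ} (f : Cw n (k + 1) w) :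
    coords e k (dW n k w f) = coords e (k + 1) f ᵥ* D := by
  classical
  induction f using Finsupp.induction_linear with
  | zero => simp
  | add f g hf hg => rw [map_add, map_add, map_add, Matrix.add_vecMul, hf, hg]
  | single M c =>
    obtain ⟨M, hk, hw⟩ := M
    obtain ⟨i, hi⟩ := e.surjective ⟨M, hw⟩
    have hM : (e i).1 = M := congrArg Subtype.val hi
    have hc : coords e (k + 1) (Finsupp.single ⟨M, hk, hw⟩ c) = Pi.single i c := by
      ext j
      by_cases hj : j = i
      · subst hj
        rw [coords_apply_of_eq e _ (by rw [hM]; exact hk)]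
        simp [hM]
      · rw [Pi.single_eq_of_ne hj]
        by_cases h : ((e j).1.card : ℤ) = k + 1
        · rw [coords_apply_of_eq e _ h, Finsupp.single_apply, if_neg]
          intro h'
          exact hj (e.injective (Subtype.ext ((congrArg Subtype.val h').symm.trans hM.symm)))
        · exact coords_apply_of_ne e _ h
    ext j
    rw [hc, Matrix.single_vecMul, Pi.smul_apply, Matrix.row_apply, hD, Matrix.of_apply, hM]
    by_cases h : ((e j).1.card : ℤ) = k
    · rw [coords_apply_of_eq e _ h, dW_single_apply, if_pos (by omega), smul_eq_mul]
    · rw [coords_apply_of_ne e _ h, if_neg (by omega), smul_zero]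

lemma IsBdryMatrix.mem_ZW_iff (hD : IsBdryMatrix e D) {k : ℤ} (f : Cw n k w) :
    f ∈ ZW n k w ↔ coords e k f ᵥ* D = 0 := by
  rw [ZW, LinearMap.mem_ker, ← map_eq_zero_iff _ (coords_injective e (k - 1)), dFromW,
    LinearMap.comp_apply, hD.coords_dW, LinearEquiv.coe_coe, coords_castCw]

lemma mem_HwSub_iff {k : ℤ} (x : ZW n k w) :
    x ∈ HwSub n k w ↔ ∃ f, dW n k w f = x.1 := by
  simp [HwSub]

/-- Vectors supported in degree `k` are carried to vectors supported in degree `k + 1` by a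
matrix `S` that raises degrees by one. -/
lemma vecMul_coords_apply_eq_zero
    (hS : ∀ i j, S.row i j ≠ 0 → (e j).1.card = (e i).1.card + 1) {k : ℤ} (f : Cw n k w) (j : ι)
    (hj : ((e j).1.card : ℤ) ≠ k + 1) : (coords e k f ᵥ* S) j = 0 := by
  refine Finset.sum_eq_zero fun i _ => ?_
  by_cases h : ((e i).1.card : ℤ) = k
  · refine mul_eq_zero_of_right _ ?_
    by_contra h'
    have := hS i j h'
    omega
  · rw [coords_apply_of_ne e _ h, zero_mul]

variable [DecidableEq ι]

/-- If the defect `1 - S D - ψ z` of the lift `S` is, after multiplication by `m ≠ 0`, of the form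
`D T`, then it vanishes on row vectors killed by `D`. -/
lemma eq_vecMul_add_of_vecMul_eq_zero (hm : m ≠ 0)
    (hT : (m : ℤ) • (1 - S * D - Matrix.vecMulVec ψ z) = D * T) {v : ι → ℤ} (hv : v ᵥ* D = 0) :
    v = (v ᵥ* S) ᵥ* D + (v ⬝ᵥ ψ) • z := by
  have h := congrArg (v ᵥ* ·) hT
  simp only [Matrix.vecMul_smul, Matrix.vecMul_sub, Matrix.vecMul_one, ← Matrix.vecMul_vecMul, hv,
    Matrix.zero_vecMul, Matrix.vecMul_vecMulVec] at h
  have h' := (smul_eq_zero.mp h).resolve_left (by exact_mod_cast hm)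
  rw [sub_sub] at h'
  exact sub_eq_zero.mp h'

theorem IsBdryMatrix.subsingleton_Hw (hD : IsBdryMatrix e D) (hm : m ≠ 0)
    (hS : ∀ i j, S.row i j ≠ 0 → (e j).1.card = (e i).1.card + 1)
    (hT : (m : ℤ) • (1 - S * D - Matrix.vecMulVec ψ z) = D * T) {k : ℤ}
    (hψ : ∀ i, ((e i).1.card : ℤ) = k → ψ i = 0) : Subsingleton (Hw n k w) := by
  refine Submodule.Quotient.subsingleton_iff.mpr (eq_top_iff.mpr fun x _ => ?_)
  obtain ⟨f, hf⟩ := exists_coords_eq e (k + 1) _ (vecMul_coords_apply_eq_zero hS x.1)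
  refine (mem_HwSub_iff x).mpr ⟨f, coords_injective e k ?_⟩
  have hψ' : coords e k x.1 ⬝ᵥ ψ = 0 := by
    refine Finset.sum_eq_zero fun i _ => ?_
    by_cases h : ((e i).1.card : ℤ) = k
    · rw [hψ i h, mul_zero]
    · rw [coords_apply_of_ne e _ h, zero_mul]
  have hx := eq_vecMul_add_of_vecMul_eq_zero hm hT ((hD.mem_ZW_iff x.1).mp x.2)
  rw [hψ', zero_smul, add_zero] at hx
  rw [hD.coords_dW, hf, ← hx]

theorem IsBdryMatrix.nonempty_Hw_equiv_zmod (hD : IsBdryMatrix e D) (hm : m ≠ 0)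
    (hS : ∀ i j, S.row i j ≠ 0 → (e j).1.card = (e i).1.card + 1)
    (hT : (m : ℤ) • (1 - S * D - Matrix.vecMulVec ψ z) = D * T) {k : ℤ}
    (hz : ∀ i, ((e i).1.card : ℤ) ≠ k → z i = 0) (hzD : z ᵥ* D = 0)
    (hψz : ((z ⬝ᵥ ψ : ℤ) : ZMod m) = 1) (hψD : ∀ i, (m : ℤ) ∣ (D *ᵥ ψ) i)
    {y : ι → ℤ} (hy : ∀ i, ((e i).1.card : ℤ) ≠ k + 1 → y i = 0)
    (hyD : y ᵥ* D = (m : ℤ) • z) : Nonempty (Hw n k w ≃ₗ[ℤ] ZMod m) := by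
  have : NeZero m := ⟨hm⟩
  let φ : ZW n k w →ₗ[ℤ] ZMod m :=
    { toFun := fun x => ((coords e k x.1 ⬝ᵥ ψ : ℤ) : ZMod m)
      map_add' := fun x x' => by simp [add_dotProduct]
      map_smul' := fun c x => by
        rw [Submodule.coe_smul, map_smul, smul_dotProduct, smul_eq_mul, Int.cast_mul,
          RingHom.id_apply, zsmul_eq_mul] }
  have hφ : ∀ x, φ x = ((coords e k x.1 ⬝ᵥ ψ : ℤ) : ZMod m) := fun _ => rfl
  have hsurj : Function.Surjective φ := by
    obtain ⟨ζ, hζ⟩ := exists_coords_eq e k z hz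
    intro a
    refine ⟨(a.val : ℤ) • ⟨ζ, (hD.mem_ZW_iff ζ).mpr (by rw [hζ, hzD])⟩, ?_⟩
    rw [map_smul, hφ, hζ, hψz]
    simp
  have hker : HwSub n k w = LinearMap.ker φ := by
    ext x
    rw [mem_HwSub_iff, LinearMap.mem_ker, hφ, ZMod.intCast_zmod_eq_zero_iff_dvd]
    constructor
    · rintro ⟨f, hf⟩
      rw [← hf, hD.coords_dW, ← Matrix.dotProduct_mulVec]
      exact Finset.dvd_sum fun i _ => Dvd.dvd.mul_left (hψD i) _
    · rintro ⟨q, hq⟩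
      obtain ⟨f, hf⟩ := exists_coords_eq e (k + 1) (coords e k x.1 ᵥ* S + q • y) (by
        intro i hi
        simp [vecMul_coords_apply_eq_zero hS x.1 i hi, hy i hi])
      refine ⟨f, coords_injective e k ?_⟩
      have hx := eq_vecMul_add_of_vecMul_eq_zero hm hT ((hD.mem_ZW_iff x.1).mp x.2)
      rw [hD.coords_dW, hf, Matrix.add_vecMul, Matrix.smul_vecMul, hyD, smul_smul, mul_comm q, ← hq,
        ← hx]
  exact ⟨(Submodule.quotEquivOfEq _ _ hker).trans (φ.quotKerEquivOfSurjective hsurj)⟩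

end Coordinates

/-- The set of index pairs occurring in a list. -/
def wedge (l : List (Fin 5 × Fin 5)) : Finset (P 5) :=
  Finset.univ.filter fun p => p.1 ∈ l

/-- The matrix whose `i`-th row has the nonzero entries `v` at the positions `j`, for `(j, v)` in
the list `r i`. -/
def ofRows {N : ℕ} (r : Fin N → List (Fin N × ℤ)) : Matrix (Fin N) (Fin N) ℤ :=
  Matrix.of fun i j => ((r i).lookup j).getD 0

/-- An injective enumeration of all the basis wedges of modified weight `w`, as an equivalence. -/
noncomputable def enumEquiv {n N : ℕ} {w : Fin n → ℤ} (b : Fin N → Finset (P n))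
    (hb : Function.Injective b) (hw : ∀ i, wt (b i) = w) (hb' : ∀ M, wt M = w → ∃ i, b i = M) :
    Fin N ≃ {M : Finset (P n) // wt M = w} :=
  Equiv.ofBijective (fun i => ⟨b i, hw i⟩)
    ⟨fun _ _ h => hb (congrArg Subtype.val h), fun M => (hb' M.1 M.2).imp fun _ h => Subtype.ext h⟩

/-- The basis wedges of modified weight `(2, 3, 4, 2, 4)`, sorted by degree. -/
def basis23424 : Fin 8 → Finset (P 5) := fun i => wedge <|
  (![[(0, 3), (1, 3), (2, 4)],
    [(0, 3), (1, 4), (2, 3)],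
    [(0, 4), (1, 3), (2, 3)],
    [(0, 1), (1, 3), (1, 4), (2, 3)],
    [(0, 2), (1, 3), (2, 3), (2, 4)],
    [(0, 3), (1, 2), (2, 3), (2, 4)],
    [(0, 3), (1, 3), (2, 3), (3, 4)],
    [(0, 1), (1, 2), (1, 3), (2, 3), (2, 4)]] : Fin 8 → List (Fin 5 × Fin 5)) i

/-- The boundary of `⟦2, 3, 4, 2, 4⟧` in the basis `basis23424`. -/
def bdry23424 : Matrix (Fin 8) (Fin 8) ℤ := ofRows
  ![[],
    [],
    [],
    [(1, -1), (2, 1)],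
    [(0, 1), (2, -1)],
    [(0, 1), (1, -1)],
    [(0, -1), (1, -1), (2, -1)],
    [(3, -1), (4, -1), (5, 1)]]

/-- A degree-raising matrix providing preimages under `bdry23424`. -/
def lift23424 : Matrix (Fin 8) (Fin 8) ℤ := ofRows
  ![[(4, 1)],
    [(3, -1)],
    [],
    [(7, -1)],
    [],
    [],
    [],
    []]

/-- A matrix witnessing that the defect of `lift23424` factors through `bdry23424`. -/
def retr23424 : Matrix (Fin 8) (Fin 8) ℤ := ofRows
  ![[(4, 1), (5, 1), (6, -1)],
    [(4, 1), (5, -2), (6, -1)],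
    [(4, -2), (5, 1), (6, -1)],
    [(7, -3)],
    [],
    [],
    [],
    []]

/-- A functional on `⟦2, 3, 4, 2, 4⟧` inducing the isomorphism from homology to `ZMod 3`. -/
def functional23424 : Fin 8 → ℤ :=
  ![1, 1, 1, 0, 0, 0, 0, 0]

/-- A cycle generating the homology of `⟦2, 3, 4, 2, 4⟧`. -/
def cycle23424 : Fin 8 → ℤ :=
  ![0, 0, 1, 0, 0, 0, 0, 0]

/-- A chain whose boundary is `3` times `cycle23424`. -/
def filling23424 : Fin 8 → ℤ :=
  ![0, 0, 0, 1, -1, 0, -1, 0]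

lemma injective_basis23424 : Function.Injective basis23424 := by
  decide +kernel

lemma wt_basis23424 : ∀ i, wt (basis23424 i) = ![2, 3, 4, 2, 4] := by
  decide +kernel

lemma exists_basis23424_eq : ∀ M : Finset (P 5), wt M = ![2, 3, 4, 2, 4] → ∃ i, basis23424 i = M := by
  decide +kernel

/-- The enumeration `basis23424` as an equivalence. -/
noncomputable def enum23424 : Fin 8 ≃ {M : Finset (P 5) // wt M = ![2, 3, 4, 2, 4]} :=
  enumEquiv basis23424 injective_basis23424 wt_basis23424 exists_basis23424_eq

lemma isBdryMatrix23424 : IsBdryMatrix enum23424 bdry23424 := by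
  change bdry23424 = Matrix.of fun i j => if (basis23424 i).card = (basis23424 j).card + 1 then
    bdryCoeff (basis23424 i) (basis23424 j) else 0
  decide +kernel

lemma card_basis_of_lift23424_ne_zero : ∀ i j, lift23424.row i j ≠ 0 →
    (basis23424 j).card = (basis23424 i).card + 1 := by
  decide +kernel

lemma lift23424_defect : (((3 : ℕ) : ℤ) • (1 - lift23424 * bdry23424 -
    Matrix.vecMulVec functional23424 cycle23424)) = bdry23424 * retr23424 := by
  decide +kernel

lemma card_basis_of_functional23424_ne_zero :
    ∀ i, functional23424 i ≠ 0 → (basis23424 i).card = 3 := by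
  decide +kernel

lemma card_basis_of_cycle23424_ne_zero :
    ∀ i, cycle23424 i ≠ 0 → (basis23424 i).card = 3 := by
  decide +kernel

lemma card_basis_of_filling23424_ne_zero :
    ∀ i, filling23424 i ≠ 0 → (basis23424 i).card = 3 + 1 := by
  decide +kernel

theorem nonempty_Hw23424 : Nonempty (Hw 5 3 ![2, 3, 4, 2, 4] ≃ₗ[ℤ] ZMod 3) := by
  refine isBdryMatrix23424.nonempty_Hw_equiv_zmod (by decide) card_basis_of_lift23424_ne_zero
    lift23424_defect (fun i hi => ?_) (by decide +kernel) (by decide +kernel) (by decide +kernel)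
    (y := filling23424) (fun i hi => ?_) (by decide +kernel)
  · contrapose! hi
    exact_mod_cast card_basis_of_cycle23424_ne_zero i hi
  · contrapose! hi
    exact_mod_cast card_basis_of_filling23424_ne_zero i hi

theorem subsingleton_Hw23424 (k : ℤ) (hk : k ≠ 3) : Subsingleton (Hw 5 k ![2, 3, 4, 2, 4]) := by
  refine isBdryMatrix23424.subsingleton_Hw (by decide) card_basis_of_lift23424_ne_zero
    lift23424_defect fun i hi => ?_
  contrapose! hk
  rw [← hi]
  exact_mod_cast card_basis_of_functional23424_ne_zero i hk

/-- The basis wedges of modified weight `(2, 3, 3, 3, 4)`, sorted by degree. -/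
def basis23334 : Fin 14 → Finset (P 5) := fun i => wedge <|
  (![[(0, 3), (1, 4)],
    [(0, 4), (1, 3)],
    [(0, 1), (1, 3), (1, 4)],
    [(0, 2), (1, 3), (2, 4)],
    [(0, 2), (1, 4), (2, 3)],
    [(0, 3), (1, 2), (2, 4)],
    [(0, 3), (1, 3), (3, 4)],
    [(0, 4), (1, 2), (2, 3)],
    [(0, 1), (1, 2), (1, 3), (2, 4)],
    [(0, 1), (1, 2), (1, 4), (2, 3)],
    [(0, 2), (1, 2), (2, 3), (2, 4)],
    [(0, 2), (1, 3), (2, 3), (3, 4)],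
    [(0, 3), (1, 2), (2, 3), (3, 4)],
    [(0, 1), (1, 2), (1, 3), (2, 3), (3, 4)]] : Fin 14 → List (Fin 5 × Fin 5)) i

/-- The boundary of `⟦2, 3, 3, 3, 4⟧` in the basis `basis23334`. -/
def bdry23334 : Matrix (Fin 14) (Fin 14) ℤ := ofRows
  ![[],
    [],
    [(0, -1), (1, 1)],
    [(1, 1)],
    [(0, 1)],
    [(0, 1)],
    [(0, 1), (1, 1)],
    [(1, 1)],
    [(2, 1), (3, -1), (5, 1)],
    [(2, -1), (4, -1), (7, 1)],
    [(3, 1), (4, -1), (5, 1), (7, -1)],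
    [(3, -1), (4, -1), (6, 1)],
    [(5, -1), (6, 1), (7, -1)],
    [(8, 1), (9, 1), (11, -1), (12, 1)]]

/-- A degree-raising matrix providing preimages under `bdry23334`. -/
def lift23334 : Matrix (Fin 14) (Fin 14) ℤ := ofRows
  ![[(2, -1), (3, 1)],
    [(3, 1)],
    [(9, -1)],
    [(11, -1)],
    [],
    [(8, 1), (9, 1), (11, -1)],
    [],
    [],
    [(13, 1)],
    [],
    [],
    [],
    [],
    []]

/-- A matrix witnessing that the defect of `lift23334` factors through `bdry23334`. -/
def retr23334 : Matrix (Fin 14) (Fin 14) ℤ := ofRows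
  ![[(6, 2), (7, -2)],
    [(7, 2)],
    [(9, -2), (10, 1), (11, 1), (12, 1)],
    [(10, 1), (11, -1), (12, 1)],
    [(10, -1), (11, -1), (12, -1)],
    [(12, -2)],
    [],
    [],
    [(13, 2)],
    [],
    [],
    [],
    [],
    []]

/-- A functional on `⟦2, 3, 3, 3, 4⟧` inducing the isomorphism from homology to `ZMod 2`. -/
def functional23334 : Fin 14 → ℤ :=
  ![0, 0, -1, -1, 1, 0, 0, 0, 0, 0, 0, 0, 0, 0]

/-- A cycle generating the homology of `⟦2, 3, 3, 3, 4⟧`. -/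
def cycle23334 : Fin 14 → ℤ :=
  ![0, 0, 0, 0, 1, 0, -1, 1, 0, 0, 0, 0, 0, 0]

/-- A chain whose boundary is `2` times `cycle23334`. -/
def filling23334 : Fin 14 → ℤ :=
  ![0, 0, 0, 0, 0, 0, 0, 0, 1, 1, -1, -2, 0, 0]

lemma injective_basis23334 : Function.Injective basis23334 := by
  decide +kernel

lemma wt_basis23334 : ∀ i, wt (basis23334 i) = ![2, 3, 3, 3, 4] := by
  decide +kernel

lemma exists_basis23334_eq : ∀ M : Finset (P 5), wt M = ![2, 3, 3, 3, 4] → ∃ i, basis23334 i = M := by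
  decide +kernel

/-- The enumeration `basis23334` as an equivalence. -/
noncomputable def enum23334 : Fin 14 ≃ {M : Finset (P 5) // wt M = ![2, 3, 3, 3, 4]} :=
  enumEquiv basis23334 injective_basis23334 wt_basis23334 exists_basis23334_eq

lemma isBdryMatrix23334 : IsBdryMatrix enum23334 bdry23334 := by
  change bdry23334 = Matrix.of fun i j => if (basis23334 i).card = (basis23334 j).card + 1 then
    bdryCoeff (basis23334 i) (basis23334 j) else 0
  decide +kernel

lemma card_basis_of_lift23334_ne_zero : ∀ i j, lift23334.row i j ≠ 0 →
    (basis23334 j).card = (basis23334 i).card + 1 := by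
  decide +kernel

lemma lift23334_defect : (((2 : ℕ) : ℤ) • (1 - lift23334 * bdry23334 -
    Matrix.vecMulVec functional23334 cycle23334)) = bdry23334 * retr23334 := by
  decide +kernel

lemma card_basis_of_functional23334_ne_zero :
    ∀ i, functional23334 i ≠ 0 → (basis23334 i).card = 3 := by
  decide +kernel

lemma card_basis_of_cycle23334_ne_zero :
    ∀ i, cycle23334 i ≠ 0 → (basis23334 i).card = 3 := by
  decide +kernel

lemma card_basis_of_filling23334_ne_zero :
    ∀ i, filling23334 i ≠ 0 → (basis23334 i).card = 3 + 1 := by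
  decide +kernel

theorem nonempty_Hw23334 : Nonempty (Hw 5 3 ![2, 3, 3, 3, 4] ≃ₗ[ℤ] ZMod 2) := by
  refine isBdryMatrix23334.nonempty_Hw_equiv_zmod (by decide) card_basis_of_lift23334_ne_zero
    lift23334_defect (fun i hi => ?_) (by decide +kernel) (by decide +kernel) (by decide +kernel)
    (y := filling23334) (fun i hi => ?_) (by decide +kernel)
  · contrapose! hi
    exact_mod_cast card_basis_of_cycle23334_ne_zero i hi
  · contrapose! hi
    exact_mod_cast card_basis_of_filling23334_ne_zero i hi

theorem subsingleton_Hw23334 (k : ℤ) (hk : k ≠ 3) : Subsingleton (Hw 5 k ![2, 3, 3, 3, 4]) := by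
  refine isBdryMatrix23334.subsingleton_Hw (by decide) card_basis_of_lift23334_ne_zero
    lift23334_defect fun i hi => ?_
  contrapose! hk
  rw [← hi]
  exact_mod_cast card_basis_of_functional23334_ne_zero i hk

/-- The basis wedges of modified weight `(2, 3, 3, 4, 3)`, sorted by degree. -/
def basis23343 : Fin 14 → Finset (P 5) := fun i => wedge <|
  (![[(0, 4), (1, 4)],
    [(0, 2), (1, 4), (2, 4)],
    [(0, 3), (1, 4), (3, 4)],
    [(0, 4), (1, 2), (2, 4)],
    [(0, 4), (1, 3), (3, 4)],
    [(0, 1), (1, 2), (1, 4), (2, 4)],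
    [(0, 1), (1, 3), (1, 4), (3, 4)],
    [(0, 2), (1, 3), (2, 4), (3, 4)],
    [(0, 2), (1, 4), (2, 3), (3, 4)],
    [(0, 3), (1, 2), (2, 4), (3, 4)],
    [(0, 4), (1, 2), (2, 3), (3, 4)],
    [(0, 1), (1, 2), (1, 3), (2, 4), (3, 4)],
    [(0, 1), (1, 2), (1, 4), (2, 3), (3, 4)],
    [(0, 2), (1, 2), (2, 3), (2, 4), (3, 4)]] : Fin 14 → List (Fin 5 × Fin 5)) i

/-- The boundary of `⟦2, 3, 3, 4, 3⟧` in the basis `basis23343`. -/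
def bdry23343 : Matrix (Fin 14) (Fin 14) ℤ := ofRows
  ![[],
    [(0, 1)],
    [(0, 1)],
    [(0, 1)],
    [(0, 1)],
    [(1, -1), (3, 1)],
    [(2, -1), (4, 1)],
    [(1, -1), (4, 1)],
    [(1, -1), (2, 1)],
    [(2, 1), (3, -1)],
    [(3, -1), (4, 1)],
    [(5, 1), (6, 1), (7, -1), (9, 1)],
    [(5, 1), (6, -1), (8, -1), (10, 1)],
    [(7, 1), (8, -1), (9, 1), (10, -1)]]

/-- A degree-raising matrix providing preimages under `bdry23343`. -/
def lift23343 : Matrix (Fin 14) (Fin 14) ℤ := ofRows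
  ![[(1, 1)],
    [(7, -1)],
    [(6, -1)],
    [(5, 1), (7, -1)],
    [],
    [(12, 1)],
    [],
    [(11, -1), (12, 1)],
    [],
    [],
    [],
    [],
    [],
    []]

/-- A matrix witnessing that the defect of `lift23343` factors through `bdry23343`. -/
def retr23343 : Matrix (Fin 14) (Fin 14) ℤ := ofRows
  ![[(4, 2)],
    [(8, -2), (9, 2), (10, -2)],
    [(9, 2), (10, -2)],
    [(10, -2)],
    [],
    [(11, 1), (12, 1), (13, 1)],
    [(11, 1), (12, -1), (13, 1)],
    [(13, 2)],
    [],
    [],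
    [],
    [],
    [],
    []]

/-- A functional on `⟦2, 3, 3, 4, 3⟧` inducing the isomorphism from homology to `ZMod 2`. -/
def functional23343 : Fin 14 → ℤ :=
  ![0, 0, 0, 0, 0, 1, 1, 2, 0, 0, 0, 0, 0, 0]

/-- A cycle generating the homology of `⟦2, 3, 3, 4, 3⟧`. -/
def cycle23343 : Fin 14 → ℤ :=
  ![0, 0, 0, 0, 0, 0, 1, 0, 0, 1, -1, 0, 0, 0]

/-- A chain whose boundary is `2` times `cycle23343`. -/
def filling23343 : Fin 14 → ℤ :=
  ![0, 0, 0, 0, 0, 0, 0, 0, 0, 0, 0, 1, -1, 1]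

lemma injective_basis23343 : Function.Injective basis23343 := by
  decide +kernel

lemma wt_basis23343 : ∀ i, wt (basis23343 i) = ![2, 3, 3, 4, 3] := by
  decide +kernel

lemma exists_basis23343_eq : ∀ M : Finset (P 5), wt M = ![2, 3, 3, 4, 3] → ∃ i, basis23343 i = M := by
  decide +kernel

/-- The enumeration `basis23343` as an equivalence. -/
noncomputable def enum23343 : Fin 14 ≃ {M : Finset (P 5) // wt M = ![2, 3, 3, 4, 3]} :=
  enumEquiv basis23343 injective_basis23343 wt_basis23343 exists_basis23343_eq

lemma isBdryMatrix23343 : IsBdryMatrix enum23343 bdry23343 := by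
  change bdry23343 = Matrix.of fun i j => if (basis23343 i).card = (basis23343 j).card + 1 then
    bdryCoeff (basis23343 i) (basis23343 j) else 0
  decide +kernel

lemma card_basis_of_lift23343_ne_zero : ∀ i j, lift23343.row i j ≠ 0 →
    (basis23343 j).card = (basis23343 i).card + 1 := by
  decide +kernel

lemma lift23343_defect : (((2 : ℕ) : ℤ) • (1 - lift23343 * bdry23343 -
    Matrix.vecMulVec functional23343 cycle23343)) = bdry23343 * retr23343 := by
  decide +kernel

lemma card_basis_of_functional23343_ne_zero :
    ∀ i, functional23343 i ≠ 0 → (basis23343 i).card = 4 := by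
  decide +kernel

lemma card_basis_of_cycle23343_ne_zero :
    ∀ i, cycle23343 i ≠ 0 → (basis23343 i).card = 4 := by
  decide +kernel

lemma card_basis_of_filling23343_ne_zero :
    ∀ i, filling23343 i ≠ 0 → (basis23343 i).card = 4 + 1 := by
  decide +kernel

theorem nonempty_Hw23343 : Nonempty (Hw 5 4 ![2, 3, 3, 4, 3] ≃ₗ[ℤ] ZMod 2) := by
  refine isBdryMatrix23343.nonempty_Hw_equiv_zmod (by decide) card_basis_of_lift23343_ne_zero
    lift23343_defect (fun i hi => ?_) (by decide +kernel) (by decide +kernel) (by decide +kernel)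
    (y := filling23343) (fun i hi => ?_) (by decide +kernel)
  · contrapose! hi
    exact_mod_cast card_basis_of_cycle23343_ne_zero i hi
  · contrapose! hi
    exact_mod_cast card_basis_of_filling23343_ne_zero i hi

theorem subsingleton_Hw23343 (k : ℤ) (hk : k ≠ 4) : Subsingleton (Hw 5 k ![2, 3, 3, 4, 3]) := by
  refine isBdryMatrix23343.subsingleton_Hw (by decide) card_basis_of_lift23343_ne_zero
    lift23343_defect fun i hi => ?_
  contrapose! hk
  rw [← hi]
  exact_mod_cast card_basis_of_functional23343_ne_zero i hk

/-- The basis wedges of modified weight `(3, 3, 3, 3, 3)`, sorted by degree. -/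
def basis33333 : Fin 24 → Finset (P 5) := fun i => wedge <|
  (![[(0, 3), (0, 4), (1, 4)],
    [(0, 1), (0, 4), (1, 3), (1, 4)],
    [(0, 2), (0, 3), (1, 4), (2, 4)],
    [(0, 2), (0, 4), (1, 3), (2, 4)],
    [(0, 2), (0, 4), (1, 4), (2, 3)],
    [(0, 3), (0, 4), (1, 2), (2, 4)],
    [(0, 3), (0, 4), (1, 3), (3, 4)],
    [(0, 1), (0, 2), (1, 3), (1, 4), (2, 4)],
    [(0, 1), (0, 3), (1, 2), (1, 4), (2, 4)],
    [(0, 1), (0, 3), (1, 3), (1, 4), (3, 4)],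
    [(0, 1), (0, 4), (1, 2), (1, 3), (2, 4)],
    [(0, 1), (0, 4), (1, 2), (1, 4), (2, 3)],
    [(0, 2), (0, 3), (1, 3), (2, 4), (3, 4)],
    [(0, 2), (0, 3), (1, 4), (2, 3), (3, 4)],
    [(0, 2), (0, 4), (1, 2), (2, 3), (2, 4)],
    [(0, 2), (0, 4), (1, 3), (2, 3), (3, 4)],
    [(0, 3), (0, 4), (1, 2), (2, 3), (3, 4)],
    [(0, 1), (0, 2), (1, 2), (1, 4), (2, 3), (2, 4)],
    [(0, 1), (0, 2), (1, 3), (1, 4), (2, 3), (3, 4)],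
    [(0, 1), (0, 3), (1, 2), (1, 3), (2, 4), (3, 4)],
    [(0, 1), (0, 3), (1, 2), (1, 4), (2, 3), (3, 4)],
    [(0, 1), (0, 4), (1, 2), (1, 3), (2, 3), (3, 4)],
    [(0, 2), (0, 3), (1, 2), (2, 3), (2, 4), (3, 4)],
    [(0, 1), (0, 2), (1, 2), (1, 3), (2, 3), (2, 4), (3, 4)]] : Fin 24 → List (Fin 5 × Fin 5)) i

/-- The boundary of `⟦3, 3, 3, 3, 3⟧` in the basis `basis33333`. -/
def bdry33333 : Matrix (Fin 24) (Fin 24) ℤ := ofRows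
  ![[],
    [(0, 1)],
    [(0, 1)],
    [],
    [(0, -1)],
    [(0, -1)],
    [(0, -1)],
    [(1, 1), (2, -1), (3, 1)],
    [(2, 1), (5, 1)],
    [(1, 1), (6, 1)],
    [(1, -1), (3, 1), (5, -1)],
    [(1, 1), (4, 1)],
    [(2, 1), (3, 1), (6, 1)],
    [(2, 1), (4, 1)],
    [(3, -1), (4, 1), (5, -1)],
    [(3, 1), (4, 1), (6, -1)],
    [(5, 1), (6, -1)],
    [(7, 1), (8, 1), (11, -1), (14, 1)],
    [(7, -1), (9, 1), (13, -1), (15, 1)],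
    [(8, -1), (9, -1), (10, -1), (12, 1)],
    [(8, -1), (9, 1), (11, -1), (13, 1), (16, 1)],
    [(10, -1), (11, -1), (15, 1), (16, -1)],
    [(12, -1), (13, 1), (14, -1), (16, -1)],
    [(17, 1), (18, 1), (19, 1), (21, -1), (22, 1)]]

/-- A degree-raising matrix providing preimages under `bdry33333`. -/
def lift33333 : Matrix (Fin 24) (Fin 24) ℤ := ofRows
  ![[(1, 1)],
    [(9, 1)],
    [(9, 1), (11, -1), (13, 1)],
    [(7, 1), (11, -1), (13, 1)],
    [(9, -1), (11, 1)],
    [(8, 1), (9, -1), (11, 1), (13, -1)],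
    [],
    [(18, -1)],
    [(20, -1)],
    [],
    [(21, -1)],
    [],
    [(19, 1), (20, -1), (21, -1)],
    [],
    [(17, 1), (18, 1), (20, 1)],
    [],
    [],
    [(23, 1)],
    [],
    [],
    [],
    [],
    [],
    []]

/-- A matrix witnessing that the defect of `lift33333` factors through `bdry33333`. -/
def retr33333 : Matrix (Fin 24) (Fin 24) ℤ := ofRows
  ![[(6, -1)],
    [(9, 1)],
    [(9, 1), (11, -1), (13, 1)],
    [(9, 1), (11, -1), (15, 1)],
    [(9, -1), (11, 1)],
    [(16, 1)],
    [],
    [(18, -1)],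
    [(20, -1)],
    [],
    [(21, -1)],
    [],
    [(19, 1), (20, -1), (21, -1)],
    [],
    [(19, -1), (20, 1), (21, 1), (22, -1)],
    [],
    [],
    [(23, 1)],
    [],
    [],
    [],
    [],
    [],
    []]

lemma injective_basis33333 : Function.Injective basis33333 := by
  decide +kernel

lemma wt_basis33333 : ∀ i, wt (basis33333 i) = ![3, 3, 3, 3, 3] := by
  decide +kernel

lemma exists_basis33333_eq : ∀ M : Finset (P 5), wt M = ![3, 3, 3, 3, 3] → ∃ i, basis33333 i = M := by
  decide +kernel

/-- The enumeration `basis33333` as an equivalence. -/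
noncomputable def enum33333 : Fin 24 ≃ {M : Finset (P 5) // wt M = ![3, 3, 3, 3, 3]} :=
  enumEquiv basis33333 injective_basis33333 wt_basis33333 exists_basis33333_eq

lemma isBdryMatrix33333 : IsBdryMatrix enum33333 bdry33333 := by
  change bdry33333 = Matrix.of fun i j => if (basis33333 i).card = (basis33333 j).card + 1 then
    bdryCoeff (basis33333 i) (basis33333 j) else 0
  decide +kernel

lemma card_basis_of_lift33333_ne_zero : ∀ i j, lift33333.row i j ≠ 0 →
    (basis33333 j).card = (basis33333 i).card + 1 := by
  decide +kernel

lemma lift33333_defect : (((1 : ℕ) : ℤ) • (1 - lift33333 * bdry33333 -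
    Matrix.vecMulVec 0 0)) = bdry33333 * retr33333 := by
  decide +kernel

theorem subsingleton_Hw33333 (k : ℤ) : Subsingleton (Hw 5 k ![3, 3, 3, 3, 3]) :=
  isBdryMatrix33333.subsingleton_Hw one_ne_zero card_basis_of_lift33333_ne_zero lift33333_defect
    fun _ _ => rfl

/-- Homology of the nontrivial weight summands of `Λ^* nil_5`:
`H_3⟦2,3,4,2,4⟧ ≅ ℤ/3`, `H_3⟦2,3,3,3,4⟧ ≅ ℤ/2`, `H_4⟦2,3,3,4,3⟧ ≅ ℤ/2`,
vanishing in all other degrees, and `H_*⟦3,3,3,3,3⟧ = 0`. -/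
theorem nil5_summands :
    (Nonempty (Hw 5 3 ![2, 3, 4, 2, 4] ≃ₗ[ℤ] ZMod 3) ∧
      ∀ k : ℤ, k ≠ 3 → Subsingleton (Hw 5 k ![2, 3, 4, 2, 4])) ∧
    (Nonempty (Hw 5 3 ![2, 3, 3, 3, 4] ≃ₗ[ℤ] ZMod 2) ∧
      ∀ k : ℤ, k ≠ 3 → Subsingleton (Hw 5 k ![2, 3, 3, 3, 4])) ∧
    (Nonempty (Hw 5 4 ![2, 3, 3, 4, 3] ≃ₗ[ℤ] ZMod 2) ∧
      ∀ k : ℤ, k ≠ 4 → Subsingleton (Hw 5 k ![2, 3, 3, 4, 3])) ∧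
    (∀ k : ℤ, Subsingleton (Hw 5 k ![3, 3, 3, 3, 3])) :=
  ⟨⟨nonempty_Hw23424, subsingleton_Hw23424⟩, ⟨nonempty_Hw23334, subsingleton_Hw23334⟩,
    ⟨nonempty_Hw23343, subsingleton_Hw23343⟩, subsingleton_Hw33333⟩

end Nil
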